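/- The set 𝔓 consisting of the monomials φ₁^i·(φ₁*)^j·u₀^k for 0 ≤ i, j ≤ q(q−1) and 0 ≤ k ≤ q−1; φ₁^i·(φ₂*)^j·u₀^k for 0 ≤ i ≤ q(q−1), 1 ≤ j ≤ q−2 and 0 ≤ k ≤ q−1; (φ₁*)^i·φ₂^j·u₀^k for 0 ≤ i ≤ q(q−1), 1 ≤ j ≤ q−2 and 0 ≤ k ≤ q−1; and φ₂^i·(φ₂*)^j·u₀^k for 1 ≤ i, j ≤ q−2 and 0 ≤ k ≤ q−1, is a set of q(q²−1)² elements of R₂^{P₂} which forms a basis of R₂^{P₂} as a free module over the subalgebra 𝒜. -/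

import Mathlib

open MvPolynomial

noncomputable section

abbrev R2 (F : Type) [Field F] : Type := MvPolynomial (Fin 4) F

/-- The action of `A ∈ GL₂(F)` on `R₂ = F[x₁,x₂,y₁,y₂]` (variables `X 0, X 1, X 2, X 3`). -/
def act {F : Type} [Field F] (A : GL (Fin 2) F) : R2 F →ₐ[F] R2 F :=
  aeval ![C ((A.val.det)⁻¹ * A.val 1 1) * X 0 - C ((A.val.det)⁻¹ * A.val 1 0) * X 1,
          C ((A.val.det)⁻¹ * A.val 0 0) * X 1 - C ((A.val.det)⁻¹ * A.val 0 1) * X 0,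
          C (A.val 0 0) * X 2 + C (A.val 0 1) * X 3,
          C (A.val 1 0) * X 2 + C (A.val 1 1) * X 3]

/-- The invariant ring `R₂^G` for a subgroup `G ≤ GL₂(F)`. -/
def invariantRing {F : Type} [Field F] (G : Subgroup (GL (Fin 2) F)) : Subalgebra F (R2 F) where
  carrier := {f | ∀ A ∈ G, act A f = f}
  mul_mem' := fun hf hg A hA => by rw [map_mul, hf A hA, hg A hA]
  add_mem' := fun hf hg A hA => by rw [map_add, hf A hA, hg A hA]
  one_mem' := fun A _ => map_one (act A)
  zero_mem' := fun A _ => map_zero (act A)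
  algebraMap_mem' := fun r A _ => (act A).commutes r

/-- `SL₂(F)` as a subgroup of `GL₂(F)`. -/
def SL2 (F : Type) [Field F] : Subgroup (GL (Fin 2) F) where
  carrier := {A | A.val.det = 1}
  one_mem' := by simp
  mul_mem' := by
    intro a b ha hb
    simp only [Set.mem_setOf_eq, Units.val_mul, Matrix.det_mul] at *
    rw [ha, hb, mul_one]
  inv_mem' := by
    intro a ha
    have h : ((a⁻¹).val * a.val).det = 1 := by
      rw [← Units.val_mul, inv_mul_cancel, Units.val_one, Matrix.det_one]
    simp only [Matrix.det_mul] at h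
    rw [Set.mem_setOf_eq] at ha ⊢
    rw [ha, mul_one] at h
    exact h

/-- `P₂(F)`: upper triangular matrices in `SL₂(F)` with 1's on the diagonal. -/
def P2 (F : Type) [Field F] : Subgroup (GL (Fin 2) F) where
  carrier := {A | A.val 0 0 = 1 ∧ A.val 1 1 = 1 ∧ A.val 1 0 = 0}
  one_mem' := by simp
  mul_mem' := by
    intro a b ha hb
    obtain ⟨ha1, ha2, ha3⟩ := ha
    obtain ⟨hb1, hb2, hb3⟩ := hb
    refine ⟨?_, ?_, ?_⟩ <;>
      simp [Units.val_mul, Matrix.mul_apply, Fin.sum_univ_two, ha1, ha2, ha3, hb1, hb2, hb3]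
  inv_mem' := by
    intro a ha
    obtain ⟨ha1, ha2, ha3⟩ := ha
    have hdet : a.val.det = 1 := by
      rw [Matrix.det_fin_two, ha1, ha2, ha3]; ring
    have hinv : (a⁻¹).val = a.val⁻¹ := by
      simp [Matrix.coe_units_inv]
    refine ⟨?_, ?_, ?_⟩ <;>
      simp [hinv, Matrix.inv_def, hdet, Matrix.adjugate_fin_two, ha1, ha2, ha3]

def d22 (F : Type) [Field F] (q : ℕ) : R2 F := X 1 * X 0 ^ q - X 0 * X 1 ^ q
def d22s (F : Type) [Field F] (q : ℕ) : R2 F := X 2 * X 3 ^ q - X 3 * X 2 ^ q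
def u0 (F : Type) [Field F] : R2 F := X 0 * X 2 + X 1 * X 3
def u1 (F : Type) [Field F] (q : ℕ) : R2 F := X 0 ^ q * X 2 + X 1 ^ q * X 3
def u1s (F : Type) [Field F] (q : ℕ) : R2 F := X 0 * X 2 ^ q + X 1 * X 3 ^ q
def phi1 (F : Type) [Field F] : R2 F := X 0
def phi2 (F : Type) [Field F] (q : ℕ) : R2 F := X 1 ^ q - X 1 * X 0 ^ (q - 1)
def phi1s (F : Type) [Field F] : R2 F := X 3
def phi2s (F : Type) [Field F] (q : ℕ) : R2 F := X 2 ^ q - X 2 * X 3 ^ (q - 1)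

/-- Setting the variable `s` to zero. -/
def killVar (F : Type) [Field F] (s : Fin 4) : R2 F →ₐ[F] R2 F :=
  aeval (Function.update X s 0)

lemma X_dvd_sub_killVar {F : Type} [Field F] (s : Fin 4) (P : R2 F) :
    X s ∣ P - killVar F s P := by
  induction P using MvPolynomial.induction_on with
  | C a => simp [killVar]
  | add p r hp hr =>
    rw [map_add, add_sub_add_comm]
    exact dvd_add hp hr
  | mul_X p i hp =>
    rw [map_mul]
    by_cases h : i = s
    · subst h
      simp [killVar]
    · have : killVar F s (X i) = X i := by simp [killVar, h]
      rw [this, ← sub_mul]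
      exact Dvd.dvd.mul_right hp _

lemma X_dvd_iff_killVar_eq_zero {F : Type} [Field F] (s : Fin 4) (P : R2 F) :
    X s ∣ P ↔ killVar F s P = 0 := by
  constructor
  · rintro ⟨Q, rfl⟩
    simp [killVar]
  · intro h
    simpa [h] using X_dvd_sub_killVar s P

lemma eq_zero_of_forall_X_pow_dvd {F : Type} [Field F] (s : Fin 4) (P : R2 F)
    (h : ∀ n : ℕ, X s ^ n ∣ P) : P = 0 := by
  by_contra hP
  obtain ⟨Q, hQ⟩ := h (P.totalDegree + 1)
  have hQ0 : Q ≠ 0 := by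
    rintro rfl
    simp [hP] at hQ
  have := totalDegree_mul_of_isDomain (pow_ne_zero (P.totalDegree + 1) (X_ne_zero (R := F) s)) hQ0
  rw [← hQ, totalDegree_X_pow] at this
  omega

/-- A finite family `v` is independent over a polynomial ring acting through `ψ`. -/
def IndepAlong {F : Type} [Field F] (ψ : R2 F →ₐ[F] R2 F) {ι : Type} [Fintype ι]
    (v : ι → R2 F) : Prop :=
  ∀ P : ι → R2 F, ∑ i, ψ (P i) * v i = 0 → ∀ i, P i = 0

/-- Infinite descent: independence follows if every relation has coefficients divisible by a
fixed variable. -/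
lemma indepAlong_of_dvd {F : Type} [Field F] {ψ : R2 F →ₐ[F] R2 F} {ι : Type} [Fintype ι]
    {v : ι → R2 F} (s : Fin 4) (hs : ψ (X s) ≠ 0)
    (h : ∀ P : ι → R2 F, ∑ i, ψ (P i) * v i = 0 → ∀ i, X s ∣ P i) : IndepAlong ψ v := by
  intro P hP i
  refine eq_zero_of_forall_X_pow_dvd s _ fun n => ?_
  induction n generalizing P with
  | zero => simp
  | succ n ih =>
    choose Q hQ using h P hP
    have hQ0 : ∑ i, ψ (Q i) * v i = 0 := by
      have : ψ (X s) * ∑ i, ψ (Q i) * v i = 0 := by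
        rw [← hP, Finset.mul_sum]
        refine Finset.sum_congr rfl fun i _ => ?_
        rw [hQ i, map_mul, mul_assoc]
      exact (mul_eq_zero.1 this).resolve_left hs
    rw [hQ i, pow_succ']
    exact mul_dvd_mul_left _ (ih Q hQ0)

lemma IndepAlong.comp {F : Type} [Field F] {ψ φ : R2 F →ₐ[F] R2 F} {ι κ : Type} [Fintype ι]
    [Fintype κ] {v : ι → R2 F} {w : κ → R2 F} (hv : IndepAlong ψ v) (hw : IndepAlong φ w) :
    IndepAlong (φ.comp ψ) (fun p : ι × κ => φ (v p.1) * w p.2) := by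
  rintro P hP ⟨i, j⟩
  refine hv (fun i => P (i, j)) (hw (fun j => ∑ i, ψ (P (i, j)) * v i) ?_ j) i
  rw [← hP, Fintype.sum_prod_type_right]
  refine Finset.sum_congr rfl fun j _ => ?_
  simp only [map_sum, map_mul, Finset.sum_mul, AlgHom.comp_apply, mul_assoc]

lemma IndepAlong.rename {F : Type} [Field F] {ψ : R2 F →ₐ[F] R2 F} {ι : Type} [Fintype ι]
    {v : ι → R2 F} (hv : IndepAlong ψ v) (σ : Fin 4 ≃ Fin 4) :
    IndepAlong (((renameEquiv F σ).toAlgHom.comp ψ).comp (renameEquiv F σ).symm.toAlgHom)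
      (fun i => renameEquiv F σ (v i)) := by
  intro P hP i
  have := hv (fun i => (renameEquiv F σ).symm (P i)) ?_ i
  · exact (EmbeddingLike.map_eq_zero_iff (f := (renameEquiv F σ).symm)).1 this
  · apply (renameEquiv F σ).injective
    simpa [map_sum] using hP

/-- Raising each variable `X s` to the power `n s`. -/
def powVars (F : Type) [Field F] (n : Fin 4 → ℕ) : R2 F →ₐ[F] R2 F :=
  aeval fun s => X s ^ n s

lemma powVars_monomial {F : Type} [Field F] (n : Fin 4 → ℕ) (m : Fin 4 →₀ ℕ) (a : F) :
    powVars F n (monomial m a) =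
      monomial (Finsupp.equivFunOnFinite.symm fun s => n s * m s) a := by
  rw [powVars, aeval_monomial, monomial_eq, Finsupp.prod_fintype _ _ (by simp),
    Finsupp.prod_fintype _ _ (by simp), algebraMap_eq]
  simp [pow_mul]

lemma coeff_powVars_mul_X_pow {F : Type} [Field F] (n : Fin 4 → ℕ) (hn : ∀ s, 0 < n s)
    (r : Fin 4) {i j : ℕ} (hi : i < n r) (hj : j < n r) (m : Fin 4 →₀ ℕ) (P : R2 F) :
    coeff ((Finsupp.equivFunOnFinite.symm fun s => n s * m s) + Finsupp.single r i)
      (powVars F n P * X r ^ j) = if j = i then coeff m P else 0 := by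
  induction P using MvPolynomial.induction_on' with
  | monomial u a =>
    rw [powVars_monomial, X_pow_eq_monomial, monomial_mul, mul_one, coeff_monomial, coeff_monomial]
    by_cases hji : j = i
    · subst hji
      simp only [add_left_inj, if_true, EmbeddingLike.apply_eq_iff_eq]
      congr 1
      rw [eq_iff_iff]
      constructor
      · intro h
        ext s
        exact Nat.eq_of_mul_eq_mul_left (hn s) (congrFun h s)
      · rintro rfl
        rfl
    · rw [if_neg hji, if_neg]
      intro h
      have := DFunLike.congr_fun h r
      simp only [Finsupp.add_apply, Finsupp.equivFunOnFinite_symm_apply_apply,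
        Finsupp.single_eq_same] at this
      have h2 := congrArg (· % n r) this
      simp only [Nat.mul_add_mod, Nat.mod_eq_of_lt hi, Nat.mod_eq_of_lt hj] at h2
      exact hji h2
  | add p q hp hq =>
    rw [map_add, add_mul, coeff_add, hp, hq]
    split_ifs <;> simp

lemma indepAlong_powVars {F : Type} [Field F] (n : Fin 4 → ℕ) (hn : ∀ s, 0 < n s)
    (r : Fin 4) (k : ℕ) (hk : n r = k) :
    IndepAlong (powVars F n) (fun j : Fin k => X r ^ (j : ℕ)) := by
  subst hk
  intro P hP i
  ext m
  have := congrArg (coeff ((Finsupp.equivFunOnFinite.symm fun s => n s * m s) +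
    Finsupp.single r (i : ℕ))) hP
  rw [coeff_sum, Finset.sum_congr rfl fun j _ =>
    coeff_powVars_mul_X_pow n hn r i.2 j.2 m (P j)] at this
  simpa [Fin.val_inj] using this

/-- The substitution `X₀ ↦ -X₀X₁`, `X₁ ↦ X₁ᴹ + X₀ᴺ`. -/
def dicksonHom (F : Type) [Field F] (M N : ℕ) : R2 F →ₐ[F] R2 F :=
  aeval ![-(X 0 * X 1), X 1 ^ M + X 0 ^ N, X 2, X 3]

/-- The powers `aⁱ` for `i ≤ N` and `bʲ` for `1 ≤ j ≤ M`. -/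
def axisPowers {R : Type} [CommRing R] (a b : R) (M N : ℕ) : Fin (N + 1) ⊕ Fin M → R :=
  Sum.elim (fun i => a ^ (i : ℕ)) (fun j => b ^ (j + 1 : ℕ))

lemma killVar_zero_dicksonHom {F : Type} [Field F] (M N : ℕ) (hN : 0 < N) (P : R2 F) :
    killVar F 0 (dicksonHom F M N P) = powVars F ![1, M, 1, 1] (killVar F 0 P) := by
  simp only [← AlgHom.comp_apply]
  congr 1
  ext s : 1
  fin_cases s <;> simp [killVar, dicksonHom, powVars, Function.update, hN.ne']

lemma killVar_one_dicksonHom {F : Type} [Field F] (M N : ℕ) (hM : 0 < M) (P : R2 F) :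
    killVar F 1 (dicksonHom F M N P) =
      renameEquiv F (Equiv.swap 0 1) (powVars F ![1, N, 1, 1] (killVar F 0 P)) := by
  have : ((killVar F 1).comp (dicksonHom F M N)) =
      ((renameEquiv F (Equiv.swap (0 : Fin 4) 1)).toAlgHom.comp
        ((powVars F ![1, N, 1, 1]).comp (killVar F 0))) := by
    ext s : 1
    fin_cases s <;> simp [killVar, dicksonHom, powVars, Function.update, hM.ne',
      Equiv.swap_apply_def]
  exact DFunLike.congr_fun this P

lemma indepAlong_dicksonHom {F : Type} [Field F] (M N : ℕ) (hN : 0 < N) :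
    IndepAlong (dicksonHom F (M + 1) N) (axisPowers (X 0) (X 1) M N) := by
  refine indepAlong_of_dvd 0 (by simp [dicksonHom]) fun P hP => ?_
  simp only [Fintype.sum_sum_type, axisPowers, Sum.elim_inl, Sum.elim_inr] at hP
  have h0 := congrArg (killVar F 0) hP
  have h1 := congrArg (killVar F 1) hP
  simp only [map_add, map_sum, map_mul, killVar_zero_dicksonHom _ _ hN, map_pow, map_zero,
    killVar_one_dicksonHom _ _ (Nat.succ_pos M)] at h0 h1
  have e00 : killVar F 0 (X 0) = 0 := by simp [killVar]
  have e01 : killVar F 0 (X 1) = X 1 := by simp [killVar]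
  have e10 : killVar F 1 (X 0) = X 0 := by simp [killVar]
  have e11 : killVar F 1 (X 1) = 0 := by simp [killVar]
  rw [e00, e01, Fin.sum_univ_succ] at h0
  rw [e10, e11, Fin.sum_univ_succ] at h1
  simp only [Fin.val_zero, pow_zero, mul_one, Fin.val_succ, ne_eq, Nat.add_eq_zero_iff,
    one_ne_zero, and_false, not_false_eq_true, zero_pow, mul_zero, Finset.sum_const_zero,
    add_zero] at h0 h1
  have k0 := indepAlong_powVars (F := F) ![1, M + 1, 1, 1]
    (by intro s; fin_cases s <;> simp) 1 (M + 1) rfl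
    (Fin.cons (killVar F 0 (P (.inl 0))) fun j => killVar F 0 (P (.inr j)))
    (by rw [Fin.sum_univ_succ]; simpa using h0)
  have k00 : killVar F 0 (P (.inl 0)) = 0 := k0 0
  rw [k00] at h1
  simp only [map_zero, zero_add] at h1
  have h2 : ∑ i : Fin N, powVars F ![1, N, 1, 1] (killVar F 0 (P (.inl i.succ))) *
      X 1 ^ (i : ℕ) = 0 := by
    apply (renameEquiv F (Equiv.swap (0 : Fin 4) 1)).injective
    apply mul_right_cancel₀ (X_ne_zero (R := F) (0 : Fin 4))
    rw [map_zero, zero_mul, ← h1, map_sum, Finset.sum_mul]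
    refine Finset.sum_congr rfl fun i _ => ?_
    rw [map_mul, mul_assoc, map_pow]
    simp [pow_succ]
  have k1 := indepAlong_powVars (F := F) ![1, N, 1, 1]
    (by intro s; fin_cases s <;> simp [hN]) 1 N rfl _ h2
  intro i
  rw [X_dvd_iff_killVar_eq_zero]
  rcases i with i | j
  · exact Fin.cases k00 k1 i
  · exact k0 j.succ

/-- The substitution by `φ₁, φ₂, φ₂*, φ₁*`. -/
def phiHom (F : Type) [Field F] (q : ℕ) : R2 F →ₐ[F] R2 F :=
  aeval ![phi1 F, phi2 F q, phi2s F q, phi1s F]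

/-- The substitution by the reductions of `φ₂, φ₂*, φ₁*` modulo `x₁`. -/
def phiHomMod (F : Type) [Field F] (q : ℕ) : R2 F →ₐ[F] R2 F :=
  aeval ![X 0, X 1 ^ q, phi2s F q, X 3]

lemma indepAlong_phiHomMod {F : Type} [Field F] (q : ℕ) (hq : 2 ≤ q) :
    IndepAlong (phiHomMod F q)
      (fun k : Fin q => (X 1 : R2 F) ^ (k : ℕ)) := by
  refine indepAlong_of_dvd 3 (by simp [phiHomMod]) fun P hP i => ?_
  rw [X_dvd_iff_killVar_eq_zero]
  have key : ∀ Q : R2 F, killVar F 3 (phiHomMod F q Q) =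
      powVars F ![1, q, q, 1] (killVar F 3 Q) := by
    intro Q
    simp only [← AlgHom.comp_apply]
    congr 1
    ext s : 1
    have : q - 1 ≠ 0 := by omega
    fin_cases s <;> simp [killVar, phiHomMod, powVars, phi2s, Function.update, this]
  refine indepAlong_powVars (F := F) ![1, q, q, 1]
    (by intro s; fin_cases s <;> simp <;> omega) 1 q rfl (fun i => killVar F 3 (P i)) ?_ i
  have := congrArg (killVar F 3) hP
  simp only [map_sum, map_mul, key, map_pow, map_zero] at this
  simpa [killVar] using this

/-- A combination of powers of `u₀` divisible by `x₁` has coefficients divisible by `φ₁`. -/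
lemma X_dvd_of_phiHom_sum {F : Type} [Field F] (q : ℕ) (hq : 2 ≤ q) (P : Fin q → R2 F)
    (hP : X 0 ∣ ∑ k, phiHom F q (P k) * u0 F ^ (k : ℕ)) (k : Fin q) : X 0 ∣ P k := by
  rw [X_dvd_iff_killVar_eq_zero] at hP ⊢
  have key : ∀ Q : R2 F, killVar F 0 (phiHom F q Q) =
      phiHomMod F q (killVar F 0 Q) := by
    intro Q
    refine DFunLike.congr_fun (f := (killVar F 0).comp (phiHom F q))
      (g := (phiHomMod F q).comp (killVar F 0)) ?_ Q
    ext s : 1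
    have : q - 1 ≠ 0 := by omega
    fin_cases s <;> simp [killVar, phiHomMod, phiHom, phi1, phi2, phi1s, phi2s, Function.update, this]
  have hu : killVar F 0 (u0 F) = X 1 * X 3 := by simp [killVar, u0]
  simp only [map_sum, map_mul, key, map_pow, hu] at hP
  have := indepAlong_phiHomMod (F := F) q hq
    (fun k => killVar F 0 (P k) * X 3 ^ (k : ℕ)) (by
      rw [← hP]
      refine Finset.sum_congr rfl fun k _ => ?_
      have h3 : phiHomMod F q (X 3) = X 3 := by simp [phiHomMod]
      rw [map_mul, map_pow, h3]
      ring) k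
  simpa using this

lemma indepAlong_phiHom {F : Type} [Field F] (q : ℕ) (hq : 2 ≤ q) :
    IndepAlong (phiHom F q) (fun k : Fin q => u0 F ^ (k : ℕ)) :=
  indepAlong_of_dvd 0 (by simp [phiHom, phi1]) fun P hP =>
    X_dvd_of_phiHom_sum q hq P (by rw [hP]; exact dvd_zero _)

/-- A submodule containing `1` and stable under multiplication by `s` contains the algebra
generated by `s`. -/
lemma mem_of_mem_adjoin_of_stable {F R : Type} [Field F] [CommRing R] [Algebra F R]
    {A : Subalgebra F R} {M : Submodule A R} (h1 : 1 ∈ M) {s : Set R}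
    (hs : ∀ g ∈ s, ∀ m ∈ M, g * m ∈ M) {x : R} (hx : x ∈ Algebra.adjoin F s) : x ∈ M := by
  have key : ∀ m ∈ M, x * m ∈ M := by
    induction hx using Algebra.adjoin_induction with
    | mem g hg => exact hs g hg
    | algebraMap r =>
      intro m hm
      exact M.smul_mem (algebraMap F A r) hm
    | add x y _ _ hx hy =>
      intro m hm
      rw [add_mul]
      exact M.add_mem (hx m hm) (hy m hm)
    | mul x y _ _ hx hy =>
      intro m hm
      rw [mul_assoc]
      exact hx _ (hy m hm)
  simpa using key 1 h1

lemma mul_mem_of_mem {F R : Type} [Field F] [CommRing R] [Algebra F R]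
    {A : Subalgebra F R} (M : Submodule A R) {a x : R} (ha : a ∈ A) (hx : x ∈ M) : a * x ∈ M :=
  M.smul_mem (⟨a, ha⟩ : A) hx

lemma mul_mem_span_of_forall {F R : Type} [Field F] [CommRing R] [Algebra F R]
    {A : Subalgebra F R} {W : Set R} {g : R}
    (h : ∀ w ∈ W, g * w ∈ Submodule.span A W) :
    ∀ m ∈ Submodule.span A W, g * m ∈ Submodule.span A W := by
  intro m hm
  induction hm using Submodule.span_induction with
  | mem w hw => exact h w hw
  | zero => simp
  | add x y _ _ hx hy =>
    rw [mul_add]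
    exact add_mem hx hy
  | smul c x _ hx =>
    rw [mul_smul_comm]
    exact Submodule.smul_mem _ _ hx

lemma axisPowers_left_mem {F R : Type} [Field F] [CommRing R] [Algebra F R]
    (A : Subalgebra F R) (a b : R) (M N : ℕ) {i : ℕ} (hi : i ≤ N) :
    a ^ i ∈ Submodule.span A (Set.range (axisPowers a b M N)) :=
  Submodule.subset_span ⟨.inl ⟨i, by omega⟩, rfl⟩

lemma axisPowers_right_mem {F R : Type} [Field F] [CommRing R] [Algebra F R]
    (A : Subalgebra F R) (a b : R) (M N : ℕ) {i : ℕ} (hi : i ≤ M) :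
    b ^ i ∈ Submodule.span A (Set.range (axisPowers a b M N)) := by
  cases i with
  | zero => simpa using axisPowers_left_mem A a b M N (Nat.zero_le N)
  | succ i => exact Submodule.subset_span ⟨.inr ⟨i, by omega⟩, rfl⟩

lemma axisPowers_span_stable {F R : Type} [Field F] [CommRing R] [Algebra F R]
    {A : Subalgebra F R} {a b : R} {M N : ℕ} (hN : 0 < N) (ht : -(a * b) ∈ A)
    (hc : b ^ (M + 1) + a ^ N ∈ A) :
    ∀ g ∈ ({a, b} : Set R), ∀ m ∈ Submodule.span A (Set.range (axisPowers a b M N)),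
      g * m ∈ Submodule.span A (Set.range (axisPowers a b M N)) := by
  have hl {i : ℕ} (hi : i ≤ N) := axisPowers_left_mem A a b M N hi
  have hr {i : ℕ} (hi : i ≤ M) := axisPowers_right_mem A a b M N hi
  set S := Submodule.span A (Set.range (axisPowers a b M N)) with hS
  have hbM : b ^ (M + 1) ∈ S := by
    have : b ^ (M + 1) = (b ^ (M + 1) + a ^ N) * a ^ 0 - a ^ N := by ring
    rw [this]
    exact sub_mem (mul_mem_of_mem S hc (hl (Nat.zero_le _))) (hl le_rfl)
  rintro g (rfl | rfl)
  · refine mul_mem_span_of_forall ?_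
    rintro _ ⟨i | j, rfl⟩
    · change g * g ^ (i : ℕ) ∈ S
      rcases (Nat.lt_succ_iff.1 i.2).lt_or_eq with h | h
      · rw [← pow_succ']
        exact hl h
      · have : g * g ^ (i : ℕ) = (b ^ (M + 1) + g ^ N) * g ^ 1 + -(g * b) * b ^ M := by
          rw [h]; ring
        rw [this]
        exact add_mem (mul_mem_of_mem S hc (hl hN)) (mul_mem_of_mem S ht (hr le_rfl))
    · change g * b ^ (j + 1 : ℕ) ∈ S
      have : g * b ^ (j + 1 : ℕ) = -(-(g * b) * b ^ (j : ℕ)) := by ring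
      rw [this]
      exact neg_mem (mul_mem_of_mem S ht (hr j.2.le))
  · refine mul_mem_span_of_forall ?_
    rintro _ ⟨i | j, rfl⟩
    · change g * a ^ (i : ℕ) ∈ S
      obtain ⟨i, hi⟩ := i
      cases i with
      | zero =>
        cases M with
        | zero => simpa using hbM
        | succ M => simpa using hr (i := 1) (by omega)
      | succ i =>
        have : g * a ^ (i + 1) = -(-(a * g) * a ^ i) := by ring
        rw [this]
        exact neg_mem (mul_mem_of_mem S ht (hl (by omega)))
    · change g * g ^ (j + 1 : ℕ) ∈ S
      rw [← pow_succ']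
      rcases (Nat.succ_le_of_lt j.2).lt_or_eq with h | h
      · exact hr h
      · have : (j : ℕ) + 1 + 1 = M + 1 := by omega
        rw [this]
        exact hbM

lemma mul_mem_mul_of_stable {A R : Type} [CommRing A] [CommRing R] [Algebra A R]
    {M N : Submodule A R} {g : R} (h : ∀ m ∈ M, g * m ∈ M) :
    ∀ m ∈ M * N, g * m ∈ M * N := by
  intro m hm
  induction hm using Submodule.mul_induction_on' with
  | mem_mul_mem x hx y hy =>
    rw [← mul_assoc]
    exact Submodule.mul_mem_mul (h x hx) hy
  | add x _ y _ hx hy =>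
    rw [mul_add]
    exact add_mem hx hy

section Shear

variable {F : Type} [Field F]

lemma act_of_mem_P2 {A : GL (Fin 2) F} (hA : A ∈ P2 F) :
    act A (X 0) = X 0 ∧ act A (X 1) = X 1 - C (A.val 0 1) * X 0 ∧
      act A (X 2) = X 2 + C (A.val 0 1) * X 3 ∧ act A (X 3) = X 3 := by
  obtain ⟨h1, h2, h3⟩ := hA
  have hdet : A.val.det = 1 := by
    rw [Matrix.det_fin_two, h1, h2, h3]; ring
  simp [act, h1, h2, h3, hdet]

lemma exists_mem_P2 (β : F) : ∃ A ∈ P2 F, A.val 0 1 = β :=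
  ⟨Matrix.GeneralLinearGroup.mkOfDetNeZero !![1, β; 0, 1] (by simp),
    by simp [P2, Matrix.GeneralLinearGroup.mkOfDetNeZero],
    by simp [Matrix.GeneralLinearGroup.mkOfDetNeZero]⟩

lemma u0_mem_invariantRing : u0 F ∈ invariantRing (P2 F) := by
  intro A hA
  obtain ⟨h0, h1, h2, h3⟩ := act_of_mem_P2 hA
  simp only [u0, map_add, map_mul, h0, h1, h2, h3]
  ring

lemma phi1_mem_invariantRing : phi1 F ∈ invariantRing (P2 F) :=
  fun _ hA => (act_of_mem_P2 hA).1

lemma phi1s_mem_invariantRing : phi1s F ∈ invariantRing (P2 F) :=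
  fun _ hA => (act_of_mem_P2 hA).2.2.2

variable {q : ℕ}

/-- After multiplication by a power of `x₁`, every polynomial is a combination of
`1, x₂, …, x₂^{q-1}` over `F[x₁, φ₂, u₀, y₂]`. -/
lemma exists_pow_mul_mem_span (hq : 2 ≤ q) (f : R2 F) :
    ∃ n : ℕ, X 0 ^ n * f ∈
      Submodule.span (Algebra.adjoin F ({phi1 F, phi2 F q, u0 F, phi1s F} : Set (R2 F)))
        (Set.range fun k : Fin q => (X 1 : R2 F) ^ (k : ℕ)) := by
  set A := Algebra.adjoin F ({phi1 F, phi2 F q, u0 F, phi1s F} : Set (R2 F)) with hA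
  have h0 : X 0 ∈ A := Algebra.subset_adjoin (by simp [phi1])
  have h3 : X 3 ∈ A := Algebra.subset_adjoin (by simp [phi1s])
  have hu : u0 F ∈ A := Algebra.subset_adjoin (by simp)
  have hp : phi2 F q ∈ A := Algebra.subset_adjoin (by simp)
  have hpow {k : ℕ} (hk : k < q) : (X 1 : R2 F) ^ k ∈
      Submodule.span A (Set.range fun k : Fin q => (X 1 : R2 F) ^ (k : ℕ)) :=
    Submodule.subset_span ⟨⟨k, hk⟩, rfl⟩
  have h1 : ∀ m ∈ Submodule.span A (Set.range fun k : Fin q => (X 1 : R2 F) ^ (k : ℕ)),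
      X 1 * m ∈ Submodule.span A (Set.range fun k : Fin q => (X 1 : R2 F) ^ (k : ℕ)) := by
    refine mul_mem_span_of_forall ?_
    rintro _ ⟨k, rfl⟩
    change X 1 * X 1 ^ (k : ℕ) ∈ _
    rw [← pow_succ']
    rcases (Nat.succ_le_of_lt k.2).lt_or_eq with h | h
    · exact hpow h
    · have e : (X 1 : R2 F) ^ (k + 1 : ℕ) = phi2 F q * X 1 ^ 0 + X 0 ^ (q - 1) * X 1 ^ 1 := by
        rw [show (k : ℕ) + 1 = q from h, phi2]; ring
      rw [e]
      exact add_mem (mul_mem_of_mem _ hp (hpow (by omega)))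
        (mul_mem_of_mem _ (pow_mem h0 _) (hpow (by omega)))
  set M := Submodule.span A (Set.range fun k : Fin q => (X 1 : R2 F) ^ (k : ℕ)) with hM
  have hshift {n k : ℕ} {f : R2 F} (hf : X 0 ^ n * f ∈ M) : X 0 ^ (k + n) * f ∈ M := by
    rw [pow_add, mul_assoc]
    exact mul_mem_of_mem M (pow_mem h0 k) hf
  induction f using MvPolynomial.induction_on with
  | C a =>
    refine ⟨0, ?_⟩
    have : (X 0 : R2 F) ^ 0 * C a = algebraMap F (R2 F) a * X 1 ^ 0 := by
      simp [algebraMap_eq]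
    rw [this]
    exact mul_mem_of_mem M (A.algebraMap_mem a) (hpow (by omega))
  | add f g hf hg =>
    obtain ⟨n, hf⟩ := hf
    obtain ⟨k, hg⟩ := hg
    refine ⟨k + n, ?_⟩
    rw [mul_add]
    refine add_mem (hshift hf) ?_
    rw [add_comm]
    exact hshift hg
  | mul_X f i hf =>
    obtain ⟨n, hf⟩ := hf
    fin_cases i
    · refine ⟨n, ?_⟩
      have : X 0 ^ n * (f * X 0) = X 0 * (X 0 ^ n * f) := by ring
      exact this ▸ mul_mem_of_mem M h0 hf
    · refine ⟨n, ?_⟩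
      have : X 0 ^ n * (f * X 1) = X 1 * (X 0 ^ n * f) := by ring
      exact this ▸ h1 _ hf
    · refine ⟨n + 1, ?_⟩
      have : X 0 ^ (n + 1) * (f * X 2) =
          u0 F * (X 0 ^ n * f) - X 3 * (X 1 * (X 0 ^ n * f)) := by
        rw [u0]; ring
      exact this ▸ sub_mem (mul_mem_of_mem M hu hf) (mul_mem_of_mem M h3 (h1 _ hf))
    · refine ⟨n, ?_⟩
      have : X 0 ^ n * (f * X 3) = X 3 * (X 0 ^ n * f) := by ring
      exact this ▸ mul_mem_of_mem M h3 hf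

lemma phiHom_mem_span_of_X_pow_mul_mem (hq : 2 ≤ q) (n : ℕ) {f : R2 F}
    (hf : X 0 ^ n * f ∈ Submodule.span (phiHom F q).range
      (Set.range fun k : Fin q => u0 F ^ (k : ℕ))) :
    f ∈ Submodule.span (phiHom F q).range (Set.range fun k : Fin q => u0 F ^ (k : ℕ)) := by
  induction n with
  | zero => simpa using hf
  | succ n ih =>
    apply ih
    obtain ⟨c, hc⟩ := (Submodule.mem_span_range_iff_exists_fun _).1 hf
    choose P hP using fun k => (c k).2
    have hc' : ∑ k, phiHom F q (P k) * u0 F ^ (k : ℕ) = X 0 ^ (n + 1) * f := by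
      rw [← hc]
      refine Finset.sum_congr rfl fun k _ => ?_
      rw [show phiHom F q (P k) = c k from hP k]
      rfl
    choose Q hQ using X_dvd_of_phiHom_sum q hq P (by
      rw [hc', pow_succ', mul_assoc]
      exact dvd_mul_right _ _)
    refine (Submodule.mem_span_range_iff_exists_fun _).2
      ⟨fun k => ⟨phiHom F q (Q k), Q k, rfl⟩, ?_⟩
    apply mul_left_cancel₀ (X_ne_zero (R := F) (0 : Fin 4))
    rw [← mul_assoc, ← pow_succ', ← hc', Finset.mul_sum]
    refine Finset.sum_congr rfl fun k _ => ?_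
    have : phiHom F q (X 0) = X 0 := by simp [phiHom, phi1]
    rw [hQ k, map_mul, this, mul_assoc]
    rfl

lemma phiHom_range (q : ℕ) :
    (phiHom F q).range = Algebra.adjoin F {phi1 F, phi2 F q, phi2s F q, phi1s F} := by
  rw [phiHom, aeval_range]
  congr 1
  simp only [Matrix.range_cons, Matrix.range_empty, Set.union_empty, Set.singleton_union]

variable [Fintype F]

lemma add_pow_card_eq (hF : Fintype.card F = q) (x y : R2 F) : (x + y) ^ q = x ^ q + y ^ q := by
  subst hF
  exact map_add (FiniteField.frobeniusAlgHom F (R2 F)) x y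

lemma sub_pow_card_eq (hF : Fintype.card F = q) (x y : R2 F) : (x - y) ^ q = x ^ q - y ^ q := by
  subst hF
  exact map_sub (FiniteField.frobeniusAlgHom F (R2 F)) x y

lemma C_pow_card_eq (hF : Fintype.card F = q) (β : F) : (C β : R2 F) ^ q = C β := by
  subst hF
  rw [← map_pow, FiniteField.pow_card]

lemma phi2_mem_invariantRing (hF : Fintype.card F = q) (hq : 0 < q) :
    phi2 F q ∈ invariantRing (P2 F) := by
  intro A hA
  obtain ⟨h0, h1, h2, h3⟩ := act_of_mem_P2 hA
  simp only [phi2, map_sub, map_mul, map_pow, h0, h1, sub_pow_card_eq hF, mul_pow,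
    C_pow_card_eq hF]
  rw [← mul_pow_sub_one hq.ne' (X 0)]
  ring

lemma phi2s_mem_invariantRing (hF : Fintype.card F = q) (hq : 0 < q) :
    phi2s F q ∈ invariantRing (P2 F) := by
  intro A hA
  obtain ⟨h0, h1, h2, h3⟩ := act_of_mem_P2 hA
  simp only [phi2s, map_sub, map_mul, map_pow, h2, h3, add_pow_card_eq hF, mul_pow,
    C_pow_card_eq hF]
  rw [← mul_pow_sub_one hq.ne' (X 3)]
  ring

lemma u0_pow_card (hF : Fintype.card F = q) (hq : 0 < q) :
    u0 F ^ q = phi1 F ^ (q - 1) * (phi1s F ^ (q - 1) * u0 F) + phi1 F ^ q * phi2s F q +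
      phi1s F ^ q * phi2 F q := by
  rw [u0, add_pow_card_eq hF, phi1, phi1s, phi2, phi2s]
  simp only [mul_pow]
  rw [← mul_pow_sub_one hq.ne' (X 0), ← mul_pow_sub_one hq.ne' (X 3)]
  ring

/-- An invariant lies in `F[x₁, φ₂, u₀, y₂]` after multiplication by a power of `x₁`. -/
lemma exists_pow_mul_mem_adjoin (hF : Fintype.card F = q) (hq : 2 ≤ q) {f : R2 F}
    (hf : f ∈ invariantRing (P2 F)) :
    ∃ n : ℕ, X 0 ^ n * f ∈
      Algebra.adjoin F ({phi1 F, phi2 F q, u0 F, phi1s F} : Set (R2 F)) := by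
  obtain ⟨n, hn⟩ := exists_pow_mul_mem_span hq f
  refine ⟨n, ?_⟩
  have hle : Algebra.adjoin F ({phi1 F, phi2 F q, u0 F, phi1s F} : Set (R2 F)) ≤
      invariantRing (P2 F) := by
    rw [Algebra.adjoin_le_iff]
    rintro g (rfl | rfl | rfl | rfl)
    · exact phi1_mem_invariantRing
    · exact phi2_mem_invariantRing hF (by omega)
    · exact u0_mem_invariantRing
    · exact phi1s_mem_invariantRing
  have hinv : X 0 ^ n * f ∈ invariantRing (P2 F) :=
    mul_mem (pow_mem phi1_mem_invariantRing n) hf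
  obtain ⟨c, hc⟩ := (Submodule.mem_span_range_iff_exists_fun _).1 hn
  have hc' : ∑ k, (c k : R2 F) * X 1 ^ (k : ℕ) = X 0 ^ n * f := hc
  let H : Polynomial (R2 F) :=
    ∑ k : Fin q, Polynomial.C (c k : R2 F) * Polynomial.X ^ (k : ℕ) -
      Polynomial.C (X 0 ^ n * f)
  have hH : H = 0 := by
    refine Polynomial.eq_zero_of_natDegree_lt_card_of_eval_eq_zero H
      (f := fun β : F => X 1 - C β * X 0) ?_ ?_ ?_
    · intro β γ h
      exact C_injective _ _ (mul_right_cancel₀ (X_ne_zero (R := F) (0 : Fin 4))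
        (sub_right_injective h))
    · intro β
      obtain ⟨A, hA, rfl⟩ := exists_mem_P2 β
      have := congrArg (act A) hc'
      rw [hinv A hA, map_sum] at this
      simp only [H, Polynomial.eval_sub, Polynomial.eval_finsetSum, Polynomial.eval_mul,
        Polynomial.eval_C, Polynomial.eval_pow, Polynomial.eval_X]
      rw [sub_eq_zero, ← this]
      refine Finset.sum_congr rfl fun k _ => ?_
      rw [map_mul, map_pow, hle (c k).2 A hA, (act_of_mem_P2 hA).2.1]
    · rw [hF]
      have hlt : max (q - 1) (q - 1) < q := by omega
      refine lt_of_le_of_lt (Polynomial.natDegree_sub_le_of_le (n := q - 1)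
        (Polynomial.natDegree_sum_le_of_forall_le _ _ fun k _ => ?_) ?_) hlt
      · exact (Polynomial.natDegree_C_mul_X_pow_le _ _).trans (Nat.le_sub_one_of_lt k.2)
      · exact (Polynomial.natDegree_C _).le.trans (Nat.zero_le _)
  have h0 := congrArg (fun p => Polynomial.coeff p 0) hH
  simp only [H, Polynomial.coeff_sub, Polynomial.finsetSum_coeff, Polynomial.coeff_C_mul,
    Polynomial.coeff_X_pow, Polynomial.coeff_C_zero, Polynomial.coeff_zero] at h0
  rw [Finset.sum_eq_single ⟨0, by omega⟩ (fun k _ hk => by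
      rw [if_neg, mul_zero]
      intro h
      exact hk (Fin.ext h.symm)) (by simp)] at h0
  simp only [if_true, mul_one] at h0
  rw [← sub_eq_zero.1 h0]
  exact (c _).2

lemma u0_mul_mem_span_of_mem (hF : Fintype.card F = q) (hq : 2 ≤ q) :
    ∀ m ∈ Submodule.span (phiHom F q).range (Set.range fun k : Fin q => u0 F ^ (k : ℕ)),
      u0 F * m ∈
        Submodule.span (phiHom F q).range (Set.range fun k : Fin q => u0 F ^ (k : ℕ)) := by
  have hpow {k : ℕ} (hk : k < q) : u0 F ^ k ∈
      Submodule.span (phiHom F q).range (Set.range fun k : Fin q => u0 F ^ (k : ℕ)) :=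
    Submodule.subset_span ⟨⟨k, hk⟩, rfl⟩
  refine mul_mem_span_of_forall ?_
  rintro _ ⟨k, rfl⟩
  change u0 F * u0 F ^ (k : ℕ) ∈ _
  rw [← pow_succ']
  rcases (Nat.succ_le_of_lt k.2).lt_or_eq with h | h
  · exact hpow h
  · have hmem {g : R2 F} (hg : g ∈ ({phi1 F, phi2 F q, phi2s F q, phi1s F} : Set (R2 F))) :
        g ∈ (phiHom F q).range := by
      rw [phiHom_range]
      exact Algebra.subset_adjoin hg
    have h1 := hmem (g := phi1 F) (by simp)
    have h2 := hmem (g := phi2 F q) (by simp)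
    have h3 := hmem (g := phi2s F q) (by simp)
    have h4 := hmem (g := phi1s F) (by simp)
    have e : u0 F ^ (k + 1 : ℕ) = phi1 F ^ (q - 1) * phi1s F ^ (q - 1) * u0 F ^ 1 +
        (phi1 F ^ q * phi2s F q + phi1s F ^ q * phi2 F q) * u0 F ^ 0 := by
      rw [show (k : ℕ) + 1 = q from h, u0_pow_card hF (by omega)]
      ring
    rw [e]
    exact add_mem (mul_mem_of_mem _ (mul_mem (pow_mem h1 _) (pow_mem h4 _)) (hpow (by omega)))
      (mul_mem_of_mem _ (add_mem (mul_mem (pow_mem h1 _) h3) (mul_mem (pow_mem h4 _) h2))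
        (hpow (by omega)))

/-- The invariants of `P₂` are generated by `φ₁, φ₂, φ₁*, φ₂*, u₀`. -/
lemma invariantRing_P2_le (hF : Fintype.card F = q) (hq : 2 ≤ q) :
    invariantRing (P2 F) ≤
      Algebra.adjoin F {phi1 F, phi2 F q, phi1s F, phi2s F q, u0 F} := by
  intro f hf
  obtain ⟨n, hn⟩ := exists_pow_mul_mem_adjoin hF hq hf
  have hmem {g : R2 F} (hg : g ∈ ({phi1 F, phi2 F q, phi2s F q, phi1s F} : Set (R2 F))) :
      g ∈ (phiHom F q).range := by
    rw [phiHom_range]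
    exact Algebra.subset_adjoin hg
  have h1 : (1 : R2 F) ∈ Submodule.span (phiHom F q).range
      (Set.range fun k : Fin q => u0 F ^ (k : ℕ)) :=
    Submodule.subset_span ⟨⟨0, by omega⟩, pow_zero _⟩
  have hspan := phiHom_mem_span_of_X_pow_mul_mem hq n
    (mem_of_mem_adjoin_of_stable h1 (by
      rintro g (rfl | rfl | rfl | rfl)
      · exact fun m hm => mul_mem_of_mem _ (hmem (by simp)) hm
      · exact fun m hm => mul_mem_of_mem _ (hmem (by simp)) hm
      · exact u0_mul_mem_span_of_mem hF hq
      · exact fun m hm => mul_mem_of_mem _ (hmem (by simp)) hm) hn)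
  obtain ⟨c, rfl⟩ := (Submodule.mem_span_range_iff_exists_fun _).1 hspan
  refine sum_mem fun k _ => mul_mem ?_ (pow_mem (Algebra.subset_adjoin (by simp)) _)
  refine Algebra.adjoin_mono ?_ ((phiHom_range q).le (c k).2)
  rintro g (rfl | rfl | rfl | rfl) <;> simp

end Shear

/-- The family `eᵢ e*ⱼ u₀ᵏ`, whose range is the monomial set of the theorem. -/
def monomialFamily (F : Type) [Field F] (m : ℕ) :
    (((Fin ((m + 2) * (m + 1) + 1) ⊕ Fin m) × (Fin ((m + 2) * (m + 1) + 1) ⊕ Fin m)) ×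
      Fin (m + 2)) → R2 F :=
  fun p => axisPowers (phi1 F) (phi2 F (m + 2)) m ((m + 2) * (m + 1)) p.1.1 *
    axisPowers (phi1s F) (phi2s F (m + 2)) m ((m + 2) * (m + 1)) p.1.2 * u0 F ^ (p.2 : ℕ)

lemma map_axisPowers {R S : Type} [CommRing R] [CommRing S] {T : Type} [FunLike T R S]
    [RingHomClass T R S] (f : T) (a b : R) (M N : ℕ) (i : Fin (N + 1) ⊕ Fin M) :
    f (axisPowers a b M N i) = axisPowers (f a) (f b) M N i := by
  rcases i with i | i <;> simp [axisPowers]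

lemma exists_indepAlong_monomialFamily (F : Type) [Field F] (m : ℕ) :
    ∃ Ψ : R2 F →ₐ[F] R2 F, IndepAlong Ψ (monomialFamily F m) ∧
      Ψ.range = Algebra.adjoin F {-(phi1 F * phi2 F (m + 2)),
        phi2 F (m + 2) ^ (m + 1) + phi1 F ^ ((m + 2) * (m + 1)),
        -(phi1s F * phi2s F (m + 2)),
        phi2s F (m + 2) ^ (m + 1) + phi1s F ^ ((m + 2) * (m + 1))} := by
  have hN : 0 < (m + 2) * (m + 1) := by positivity
  have h1 := indepAlong_dicksonHom (F := F) m _ hN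
  have h2 := (h1.comp (h1.rename Fin.revPerm)).comp (indepAlong_phiHom (F := F) (m + 2) (by omega))
  have : ((phiHom F (m + 2)).comp
      ((((renameEquiv F Fin.revPerm).toAlgHom.comp
        (dicksonHom F (m + 1) ((m + 2) * (m + 1)))).comp
          (renameEquiv F Fin.revPerm).symm.toAlgHom).comp
            (dicksonHom F (m + 1) ((m + 2) * (m + 1))))) =
      aeval ![-(phi1 F * phi2 F (m + 2)),
        phi2 F (m + 2) ^ (m + 1) + phi1 F ^ ((m + 2) * (m + 1)),
        phi2s F (m + 2) ^ (m + 1) + phi1s F ^ ((m + 2) * (m + 1)),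
        -(phi1s F * phi2s F (m + 2))] := by
    ext s : 1
    fin_cases s <;> simp [phiHom, dicksonHom]
  rw [this] at h2
  refine ⟨aeval ![-(phi1 F * phi2 F (m + 2)),
    phi2 F (m + 2) ^ (m + 1) + phi1 F ^ ((m + 2) * (m + 1)),
    phi2s F (m + 2) ^ (m + 1) + phi1s F ^ ((m + 2) * (m + 1)),
    -(phi1s F * phi2s F (m + 2))], ?_, ?_⟩
  · convert h2 using 1
    funext p
    simp only [monomialFamily, map_mul, map_axisPowers]
    congr 3 <;> simp [phiHom, dicksonHom]
  · rw [aeval_range]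
    simp only [Matrix.range_cons, Matrix.range_empty, Set.union_empty, Set.singleton_union]
    congr 3
    exact Set.pair_comm _ _

open scoped Pointwise in
/-- The monomial family spans the invariants of `P₂`. -/
lemma mem_span_monomialFamily (F : Type) [Field F] [Fintype F] (m : ℕ)
    (hF : Fintype.card F = m + 2) (A : Subalgebra F (R2 F))
    (ht : -(phi1 F * phi2 F (m + 2)) ∈ A)
    (hc : phi2 F (m + 2) ^ (m + 1) + phi1 F ^ ((m + 2) * (m + 1)) ∈ A)
    (hts : -(phi1s F * phi2s F (m + 2)) ∈ A)
    (hcs : phi2s F (m + 2) ^ (m + 1) + phi1s F ^ ((m + 2) * (m + 1)) ∈ A)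
    {f : R2 F} (hf : f ∈ invariantRing (P2 F)) :
    f ∈ Submodule.span A (Set.range (monomialFamily F m)) := by
  have hN : 0 < (m + 2) * (m + 1) := by positivity
  have hs := axisPowers_span_stable hN ht hc
  have hss := axisPowers_span_stable hN hts hcs
  set E := Set.range (axisPowers (phi1 F) (phi2 F (m + 2)) m ((m + 2) * (m + 1))) with hE
  set E' := Set.range (axisPowers (phi1s F) (phi2s F (m + 2)) m ((m + 2) * (m + 1))) with hE'
  let U : Set (R2 F) := Set.range fun k : Fin (m + 2) => u0 F ^ (k : ℕ)
  have hrange : Set.range (monomialFamily F m) = E * E' * U := by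
    ext g
    simp only [Set.mem_mul, hE, hE', U, Set.mem_range, monomialFamily, Prod.exists]
    constructor
    · rintro ⟨i, j, k, rfl⟩
      exact ⟨_, ⟨_, ⟨i, rfl⟩, _, ⟨j, rfl⟩, rfl⟩, _, ⟨k, rfl⟩, rfl⟩
    · rintro ⟨_, ⟨_, ⟨i, rfl⟩, _, ⟨j, rfl⟩, rfl⟩, _, ⟨k, rfl⟩, rfl⟩
      exact ⟨i, j, k, rfl⟩
  rw [hrange, ← Submodule.span_mul_span, ← Submodule.span_mul_span]
  set S := Submodule.span A E with hS
  set S' := Submodule.span A E' with hS'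
  have h1S : (1 : R2 F) ∈ S := Submodule.subset_span ⟨.inl 0, pow_zero _⟩
  have h1S' : (1 : R2 F) ∈ S' := Submodule.subset_span ⟨.inl 0, pow_zero _⟩
  have hU {k : ℕ} (hk : k < m + 2) : u0 F ^ k ∈ Submodule.span A U :=
    Submodule.subset_span ⟨⟨k, hk⟩, rfl⟩
  have h1U : (1 : R2 F) ∈ Submodule.span A U := by simpa using hU (k := 0) (by omega)
  have hleft : ∀ g ∈ ({phi1 F, phi2 F (m + 2)} : Set (R2 F)), ∀ x ∈ S * S', g * x ∈ S * S' :=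
    fun g hg => mul_mem_mul_of_stable (hs g hg)
  have hright : ∀ g ∈ ({phi1s F, phi2s F (m + 2)} : Set (R2 F)),
      ∀ x ∈ S * S', g * x ∈ S * S' := by
    intro g hg
    rw [mul_comm S S']
    exact mul_mem_mul_of_stable (hss g hg)
  have hpow {g : R2 F} (hg : ∀ x ∈ S * S', g * x ∈ S * S') (n : ℕ) :
      ∀ x ∈ S * S', g ^ n * x ∈ S * S' := by
    induction n with
    | zero => simp
    | succ n ih =>
      intro x hx
      rw [pow_succ', mul_assoc]
      exact hg _ (ih x hx)
  have hu : ∀ x ∈ S * S' * Submodule.span A U, u0 F * x ∈ S * S' * Submodule.span A U := by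
    intro x hx
    induction hx using Submodule.mul_induction_on' with
    | mem_mul_mem x hx y hy =>
      induction hy using Submodule.span_induction with
      | mem w hw =>
        obtain ⟨k, rfl⟩ := hw
        change u0 F * (x * u0 F ^ (k : ℕ)) ∈ _
        have e : u0 F * (x * u0 F ^ (k : ℕ)) = x * u0 F ^ (k + 1 : ℕ) := by ring
        rw [e]
        rcases (Nat.succ_le_of_lt k.2).lt_or_eq with h | h
        · exact Submodule.mul_mem_mul hx (hU h)
        · have e2 : x * u0 F ^ (k + 1 : ℕ) =
              phi1 F ^ (m + 1) * (phi1s F ^ (m + 1) * x) * u0 F ^ 1 +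
              (phi2s F (m + 2) * (phi1 F ^ (m + 2) * x) +
                phi2 F (m + 2) * (phi1s F ^ (m + 2) * x)) * 1 := by
            rw [show (k : ℕ) + 1 = m + 2 from h, u0_pow_card hF (by omega),
              show m + 2 - 1 = m + 1 from rfl]
            ring
          rw [e2]
          exact add_mem
            (Submodule.mul_mem_mul (hpow (hleft _ (by simp)) _ _
              (hpow (hright _ (by simp)) _ _ hx)) (hU (by omega)))
            (Submodule.mul_mem_mul (add_mem
              (hright _ (by simp) _ (hpow (hleft _ (by simp)) _ _ hx))
              (hleft _ (by simp) _ (hpow (hright _ (by simp)) _ _ hx))) h1U)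
      | zero => simp
      | add y z _ _ hy hz =>
        rw [mul_add, mul_add]
        exact add_mem hy hz
      | smul c y _ hy =>
        rw [mul_smul_comm, mul_smul_comm]
        exact Submodule.smul_mem _ _ hy
    | add x _ y _ hx hy =>
      rw [mul_add]
      exact add_mem hx hy
  refine mem_of_mem_adjoin_of_stable ?_ ?_ (invariantRing_P2_le hF (by omega) hf)
  · simpa using Submodule.mul_mem_mul (Submodule.mul_mem_mul h1S h1S') h1U
  · rintro g (rfl | rfl | rfl | rfl | rfl)
    · exact mul_mem_mul_of_stable (hleft _ (by simp))
    · exact mul_mem_mul_of_stable (hleft _ (by simp))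
    · exact mul_mem_mul_of_stable (hright _ (by simp))
    · exact mul_mem_mul_of_stable (hright _ (by simp))
    · exact hu

/-- `d₂₂ = -φ₁φ₂` and `c₂₁ = φ₂^{q-1} + φ₁^{q(q-1)}`. -/
lemma dickson_identity (F : Type) [Field F] [Fintype F] (m : ℕ) (hF : Fintype.card F = m + 2)
    (x y : R2 F) :
    y * x ^ (m + 2) - x * y ^ (m + 2) = -(x * (y ^ (m + 2) - y * x ^ (m + 1))) ∧
    (y * x ^ (m + 2) - x * y ^ (m + 2)) *
      ((y ^ (m + 2) - y * x ^ (m + 1)) ^ (m + 1) + x ^ ((m + 2) * (m + 1))) =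
      y * x ^ ((m + 2) ^ 2) - x * y ^ ((m + 2) ^ 2) := by
  have h : y * x ^ (m + 2) - x * y ^ (m + 2) = -(x * (y ^ (m + 2) - y * x ^ (m + 1))) := by ring
  refine ⟨h, ?_⟩
  have hp : (y ^ (m + 2) - y * x ^ (m + 1)) ^ (m + 2) =
      y ^ ((m + 2) ^ 2) - y ^ (m + 2) * x ^ ((m + 1) * (m + 2)) := by
    rw [sub_pow_card_eq hF, mul_pow, ← pow_mul, ← pow_mul, ← sq]
  rw [h]
  have : -(x * (y ^ (m + 2) - y * x ^ (m + 1))) *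
      ((y ^ (m + 2) - y * x ^ (m + 1)) ^ (m + 1) + x ^ ((m + 2) * (m + 1))) =
      -x * (y ^ (m + 2) - y * x ^ (m + 1)) ^ (m + 2) -
      x * (y ^ (m + 2) - y * x ^ (m + 1)) * x ^ ((m + 2) * (m + 1)) := by ring
  rw [this, hp]
  ring

lemma mul_X_pow_sub_ne_zero (F : Type) [Field F] (m : ℕ) {i j : Fin 4} (hij : i ≠ j) :
    (X j * X i ^ (m + 2) - X i * X j ^ (m + 2) : R2 F) ≠ 0 := by
  intro h
  have := congrArg (coeff (Finsupp.single j 1 + Finsupp.single i (m + 2))) h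
  rw [X_pow_eq_monomial, X_pow_eq_monomial, X, X, monomial_mul, monomial_mul, coeff_sub,
    coeff_monomial, coeff_monomial, if_pos rfl, if_neg] at this
  · simp at this
  · intro h
    have := DFunLike.congr_fun h i
    simp [hij] at this

/-- the explicit monomial set `𝔓` is a set of `q(q²−1)²` elements of
`R₂^{P₂}` forming a basis of `R₂^{P₂}` as a free module over `𝒜`. -/
theorem stmt_2 (q : ℕ) (hq : IsPrimePow q) (F : Type) [Field F] [Fintype F]
    (hF : Fintype.card F = q)
    (c21 c21s : R2 F)
    (hc21 : d22 F q * c21 = X 1 * X 0 ^ (q ^ 2) - X 0 * X 1 ^ (q ^ 2))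
    (hc21s : d22s F q * c21s = X 2 * X 3 ^ (q ^ 2) - X 3 * X 2 ^ (q ^ 2))
    (𝔓 : Set (R2 F))
    (h𝔓 : 𝔓 =
      {f | ∃ i j k, i ≤ q * (q - 1) ∧ j ≤ q * (q - 1) ∧ k ≤ q - 1 ∧
        f = phi1 F ^ i * phi1s F ^ j * u0 F ^ k} ∪
      {f | ∃ i j k, i ≤ q * (q - 1) ∧ 1 ≤ j ∧ j ≤ q - 2 ∧ k ≤ q - 1 ∧
        f = phi1 F ^ i * phi2s F q ^ j * u0 F ^ k} ∪
      {f | ∃ i j k, i ≤ q * (q - 1) ∧ 1 ≤ j ∧ j ≤ q - 2 ∧ k ≤ q - 1 ∧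
        f = phi1s F ^ i * phi2 F q ^ j * u0 F ^ k} ∪
      {f | ∃ i j k, 1 ≤ i ∧ i ≤ q - 2 ∧ 1 ≤ j ∧ j ≤ q - 2 ∧ k ≤ q - 1 ∧
        f = phi2 F q ^ i * phi2s F q ^ j * u0 F ^ k}) :
    𝔓.ncard = q * (q ^ 2 - 1) ^ 2 ∧
    𝔓 ⊆ (invariantRing (P2 F) : Set (R2 F)) ∧
    (∀ f ∈ invariantRing (P2 F),
      f ∈ Submodule.span (Algebra.adjoin F {d22 F q, c21, d22s F q, c21s}) 𝔓) ∧
    LinearIndependent (Algebra.adjoin F {d22 F q, c21, d22s F q, c21s})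
      (fun b : 𝔓 => (b : R2 F)) := by
  have hq2 : 2 ≤ q := hq.two_le
  obtain ⟨m, rfl⟩ := Nat.exists_eq_add_of_le' hq2
  obtain ⟨Ψ, hΨ, hrange⟩ := exists_indepAlong_monomialFamily F m
  obtain ⟨hd, hdc⟩ := dickson_identity F m hF (X 0) (X 1)
  obtain ⟨hds, hdcs⟩ := dickson_identity F m hF (X 3) (X 2)
  have ed : d22 F (m + 2) = -(phi1 F * phi2 F (m + 2)) := hd
  have eds : d22s F (m + 2) = -(phi1s F * phi2s F (m + 2)) := hds
  have ec : c21 = phi2 F (m + 2) ^ (m + 1) + phi1 F ^ ((m + 2) * (m + 1)) :=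
    mul_left_cancel₀ (mul_X_pow_sub_ne_zero F m (by decide)) (hc21.trans hdc.symm)
  have ecs : c21s = phi2s F (m + 2) ^ (m + 1) + phi1s F ^ ((m + 2) * (m + 1)) :=
    mul_left_cancel₀ (mul_X_pow_sub_ne_zero F m (by decide)) (hc21s.trans hdcs.symm)
  rw [ed, eds, ec, ecs]
  clear hc21 hc21s ec ecs
  set A := Algebra.adjoin F {-(phi1 F * phi2 F (m + 2)),
        phi2 F (m + 2) ^ (m + 1) + phi1 F ^ ((m + 2) * (m + 1)),
        -(phi1s F * phi2s F (m + 2)),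
        phi2s F (m + 2) ^ (m + 1) + phi1s F ^ ((m + 2) * (m + 1))} with hA
  have hlin : LinearIndependent A (monomialFamily F m) := by
    rw [Fintype.linearIndependent_iff]
    intro g hg i
    choose P hP using fun i => hrange.ge (g i).2
    have := hΨ P (by
      rw [← hg]
      refine Finset.sum_congr rfl fun i _ => ?_
      rw [show Ψ (P i) = g i from hP i]
      rfl) i
    apply Subtype.ext
    rw [← hP i, this]
    exact map_zero Ψ
  have hset : 𝔓 = Set.range (monomialFamily F m) := by
    rw [h𝔓]
    ext f
    constructor
    · rintro (((⟨i, j, k, hi, hj, hk, rfl⟩ | ⟨i, j, k, hi, hj, hj', hk, rfl⟩) |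
        ⟨i, j, k, hi, hj, hj', hk, rfl⟩) | ⟨i, j, k, hi, hi', hj, hj', hk, rfl⟩)
      · exact ⟨((.inl ⟨i, Nat.lt_succ_of_le hi⟩, .inl ⟨j, Nat.lt_succ_of_le hj⟩),
          ⟨k, Nat.lt_succ_of_le hk⟩), rfl⟩
      · obtain ⟨j, rfl⟩ := Nat.exists_eq_add_of_le' hj
        exact ⟨((.inl ⟨i, Nat.lt_succ_of_le hi⟩, .inr ⟨j, hj'⟩), ⟨k, Nat.lt_succ_of_le hk⟩), rfl⟩
      · obtain ⟨j, rfl⟩ := Nat.exists_eq_add_of_le' hj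
        exact ⟨((.inr ⟨j, hj'⟩, .inl ⟨i, Nat.lt_succ_of_le hi⟩), ⟨k, Nat.lt_succ_of_le hk⟩),
          by simp only [monomialFamily, axisPowers, Sum.elim_inl, Sum.elim_inr]; ring⟩
      · obtain ⟨i, rfl⟩ := Nat.exists_eq_add_of_le' hi
        obtain ⟨j, rfl⟩ := Nat.exists_eq_add_of_le' hj
        exact ⟨((.inr ⟨i, hi'⟩, .inr ⟨j, hj'⟩), ⟨k, Nat.lt_succ_of_le hk⟩), rfl⟩
    · rintro ⟨⟨⟨i | i, j | j⟩, k⟩, rfl⟩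
      · exact .inl (.inl (.inl ⟨i, j, k, Nat.le_of_lt_succ i.2, Nat.le_of_lt_succ j.2,
          Nat.le_of_lt_succ k.2, rfl⟩))
      · exact .inl (.inl (.inr ⟨i, j + 1, k, Nat.le_of_lt_succ i.2, Nat.le_add_left _ _, j.2,
          Nat.le_of_lt_succ k.2, rfl⟩))
      · exact .inl (.inr ⟨j, i + 1, k, Nat.le_of_lt_succ j.2, Nat.le_add_left _ _, i.2,
          Nat.le_of_lt_succ k.2,
          by simp only [monomialFamily, axisPowers, Sum.elim_inl, Sum.elim_inr]; ring⟩)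
      · exact .inr ⟨i + 1, j + 1, k, Nat.le_add_left _ _, i.2, Nat.le_add_left _ _, j.2,
          Nat.le_of_lt_succ k.2, rfl⟩
  subst hset
  clear h𝔓
  refine ⟨?_, ?_, ?_, ?_⟩
  · rw [← Set.image_univ, Set.ncard_image_of_injective _ hlin.injective, Set.ncard_univ,
      Nat.card_eq_fintype_card]
    simp only [Fintype.card_prod, Fintype.card_sum, Fintype.card_fin]
    have : (m + 2) ^ 2 - 1 = (m + 2) * (m + 1) + 1 + m := by
      rw [Nat.sub_eq_iff_eq_add (Nat.one_le_pow _ _ (by omega))]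
      ring
    rw [this]
    ring
  · have h1 := phi1_mem_invariantRing (F := F)
    have h2 := phi2_mem_invariantRing hF (by omega)
    have h3 := phi1s_mem_invariantRing (F := F)
    have h4 := phi2s_mem_invariantRing hF (by omega)
    rintro _ ⟨⟨⟨i | i, j | j⟩, k⟩, rfl⟩ <;>
    · refine mul_mem (mul_mem ?_ ?_) (pow_mem u0_mem_invariantRing _) <;>
      · apply pow_mem
        assumption
  · intro f hf
    exact mem_span_monomialFamily F m hF A (Algebra.subset_adjoin (by simp))
      (Algebra.subset_adjoin (by simp)) (Algebra.subset_adjoin (by simp))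
      (Algebra.subset_adjoin (by simp)) hf
  · exact hlin.linearIndepOn_id
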